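/- arXiv:1302.1684 — 2 statements merged into one kernel-verified Lean document; each statement's English description precedes it below -/
import Mathlib

section
/- For all integers n ≥ d ≥ 2, the number of acyclic d-tournaments satisfies a_d(n) ≥ ∏_{k=d−1}^{n−1} a_{d−1}(k). -/
open Finset

/-- The induced-orientation sign `(τ;σ)`: if `τ ⊆ σ` and `|τ| + 1 = |σ|`, with
`σ = {i₀ < … < i_d}` and `τ = σ \ {i_j}`, this is `(-1)^(d - j)`; otherwise `0`. -/
def relSign (τ σ : Finset ℕ) : ℤ :=
  if τ ⊆ σ ∧ τ.card + 1 = σ.card then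
    ∑ x ∈ σ \ τ, (-1 : ℤ) ^ (σ.card - 1 - (σ.filter (fun y => y < x)).card)
  else 0

/-- A `d`-tournament on vertex set `V`: a sign `±1` for each `(d+1)`-element subset of `V`
(encoded as a function on all finsets, vanishing elsewhere).  The column of the incidence
matrix indexed by a face `F` is the function `fun τ => ε F * relSign τ F`. -/
def IsTournament (V : Finset ℕ) (d : ℕ) (ε : Finset ℕ → ℤ) : Prop :=
  ∀ σ : Finset ℕ,
    (σ ⊆ V ∧ σ.card = d + 1 → ε σ = 1 ∨ ε σ = -1) ∧
    (¬(σ ⊆ V ∧ σ.card = d + 1) → ε σ = 0)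

/-- `C` is a cycle: a nonempty set of `(d+1)`-element subsets of `V` admitting positive
real coefficients whose weighted incidence-matrix column sum vanishes. -/
def IsCycle (V : Finset ℕ) (d : ℕ) (ε : Finset ℕ → ℤ) (C : Finset (Finset ℕ)) : Prop :=
  C.Nonempty ∧ (∀ F ∈ C, F ⊆ V ∧ F.card = d + 1) ∧
    ∃ v : Finset ℕ → ℝ, (∀ F ∈ C, 0 < v F) ∧
      ∀ τ : Finset ℕ, ∑ F ∈ C, v F * ((ε F : ℝ) * (relSign τ F : ℝ)) = 0

def IsAcyclic (V : Finset ℕ) (d : ℕ) (ε : Finset ℕ → ℤ) : Prop :=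
  ∀ C : Finset (Finset ℕ), ¬ IsCycle V d ε C

/-- `a_d(n)`: the number of acyclic `d`-tournaments on vertex set `[n]`. -/
noncomputable def acyclicCount (d n : ℕ) : ℕ :=
  Nat.card {ε : Finset ℕ → ℤ //
    IsTournament (Finset.range n) d ε ∧ IsAcyclic (Finset.range n) d ε}

/-- Restriction (subtournament) of `ε` to the subsets of `S`. -/
def restrict (S : Finset ℕ) (ε : Finset ℕ → ℤ) : Finset ℕ → ℤ :=
  fun σ => if σ ⊆ S then ε σ else 0

/-- The link of the vertex `x`: it orients `τ` as the orientation induced on `τ`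
by `τ ∪ {x}`. -/
def link (ε : Finset ℕ → ℤ) (x : ℕ) : Finset ℕ → ℤ :=
  fun τ => ε (insert x τ) * relSign τ (insert x τ)

/-- The degree sequence `A · 1⃗`. -/
def degSeq (V : Finset ℕ) (d : ℕ) (ε : Finset ℕ → ℤ) : Finset ℕ → ℤ :=
  fun τ => ∑ F ∈ V.powersetCard (d + 1), ε F * relSign τ F

/-- A `0/1`-cycle: a nonempty set of faces whose incidence-matrix columns sum to zero. -/
def Is01Cycle (V : Finset ℕ) (d : ℕ) (ε : Finset ℕ → ℤ) (C : Finset (Finset ℕ)) : Prop :=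
  C.Nonempty ∧ (∀ F ∈ C, F ⊆ V ∧ F.card = d + 1) ∧
    ∀ τ : Finset ℕ, ∑ F ∈ C, ε F * relSign τ F = 0

/-- `U` is a `(d+2)`-cycle: the set of all its `(d+1)`-element subsets is a cycle. -/
def IsDCycle (V : Finset ℕ) (d : ℕ) (ε : Finset ℕ → ℤ) (U : Finset ℕ) : Prop :=
  U ⊆ V ∧ U.card = d + 2 ∧ IsCycle V d ε (U.powersetCard (d + 1))

/-- A `d`-element subset `τ` of `V` is free if all nonzero entries of its row
in the incidence matrix have the same sign. -/
def IsFree (V : Finset ℕ) (d : ℕ) (ε : Finset ℕ → ℤ) (τ : Finset ℕ) : Prop :=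
  τ ⊆ V ∧ τ.card = d ∧
    ((∀ σ ∈ V.powersetCard (d + 1), 0 ≤ ε σ * relSign τ σ) ∨
     (∀ σ ∈ V.powersetCard (d + 1), ε σ * relSign τ σ ≤ 0))

/-- An elementary collapse at a free `d`-face `τ`: all faces containing `τ` get sign `0`. -/
def CollapseStep (V : Finset ℕ) (d : ℕ) (ε ε' : Finset ℕ → ℤ) : Prop :=
  ∃ τ : Finset ℕ, IsFree V d ε τ ∧ ε' = fun σ => if τ ⊆ σ then 0 else ε σ

/-- Collapsibility: a finite sequence of elementary collapses reaching the zero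
partial tournament. -/
def Collapsible (V : Finset ℕ) (d : ℕ) (ε : Finset ℕ → ℤ) : Prop :=
  Relation.ReflTransGen (CollapseStep V d) ε (fun _ => 0)

/-- Realizability in `ℝ^d`: the orientations are induced by a general-position embedding
of the vertices, i.e. `ε σ` is the sign of the (nonzero) orientation determinant of the
points of `σ` listed in increasing order. -/
def Realizable (n d : ℕ) (ε : Finset ℕ → ℤ) : Prop :=
  ∃ ι : ℕ → Fin d → ℝ, ∀ σ : Finset ℕ, σ ⊆ Finset.range n → ∀ hσ : σ.card = d + 1,
    0 < (ε σ : ℝ) * Matrix.det (Matrix.of fun k l : Fin d =>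
      ι ((σ.orderIsoOfFin hσ) k.succ : ℕ) l - ι ((σ.orderIsoOfFin hσ) 0 : ℕ) l)

/-- The set of tournaments on `range n` is finite. -/
theorem finite_acyclic_tournaments (d n : ℕ) :
    Finite {ε : Finset ℕ → ℤ //
      IsTournament (Finset.range n) d ε ∧ IsAcyclic (Finset.range n) d ε} := by
  have hmem : ∀ ε : Finset ℕ → ℤ, IsTournament (Finset.range n) d ε →
      ∀ σ, ε σ ∈ ({-1, 0, 1} : Finset ℤ) := by
    intro ε hε σ
    by_cases h : σ ⊆ Finset.range n ∧ σ.card = d + 1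
    · rcases (hε σ).1 h with h | h <;> simp [h]
    · simp [(hε σ).2 h]
  refine Finite.of_injective
    (fun ε (σ : (Finset.range n).powerset) =>
      (⟨ε.1 σ.1, hmem ε.1 ε.2.1 σ.1⟩ : ({-1, 0, 1} : Finset ℤ))) ?_
  intro ε ε' h
  refine Subtype.ext (funext fun σ => ?_)
  by_cases hσ : σ ⊆ Finset.range n
  · exact congrArg Subtype.val (congrFun h ⟨σ, Finset.mem_powerset.2 hσ⟩)
  · rw [(ε.2.1 σ).2 fun h => hσ h.1, (ε'.2.1 σ).2 fun h => hσ h.1]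

/-- There is exactly one acyclic `d`-tournament, the empty one, on at most `d` vertices. -/
theorem acyclicCount_eq_one_of_le {d n : ℕ} (h : n ≤ d) : acyclicCount d n = 1 := by
  have hno : ∀ σ : Finset ℕ, ¬ (σ ⊆ Finset.range n ∧ σ.card = d + 1) := by
    rintro σ ⟨hσ, hc⟩
    have := Finset.card_le_card hσ
    rw [Finset.card_range] at this
    omega
  refine Nat.card_eq_one_iff_unique.2 ⟨⟨fun ε ε' => Subtype.ext (funext fun σ => ?_)⟩,
    ⟨⟨fun _ => 0, fun σ => ⟨fun hσ => absurd hσ (hno σ), fun _ => rfl⟩, ?_⟩⟩⟩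
  · rw [(ε.2.1 σ).2 (hno σ), (ε'.2.1 σ).2 (hno σ)]
  · rintro C ⟨⟨F, hF⟩, hC, -⟩
    exact hno F (hC F hF)

/-- Adding a common last vertex to `τ` and `F` reverses the relative sign. -/
theorem relSign_insert_insert {m : ℕ} {τ F : Finset ℕ} (hτ : m ∉ τ) (hF : F ⊆ Finset.range m) :
    relSign (insert m τ) (insert m F) = -relSign τ F := by
  have hmF : m ∉ F := fun h => by simpa using hF h
  have hsub : insert m τ ⊆ insert m F ↔ τ ⊆ F := Finset.insert_subset_insert_iff hτ
  have hsdiff : insert m F \ insert m τ = F \ τ := by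
    rw [Finset.insert_sdiff_insert, Finset.sdiff_insert_of_notMem hmF]
  unfold relSign
  simp only [hsub, hsdiff, Finset.card_insert_of_notMem hτ, Finset.card_insert_of_notMem hmF,
    Nat.add_right_cancel_iff]
  split_ifs
  · rw [← Finset.sum_neg_distrib]
    refine Finset.sum_congr rfl fun x hx => ?_
    have hxF := (Finset.mem_sdiff.1 hx).1
    have hxm : ¬ m < x := not_lt.2 (Finset.mem_range.1 (hF hxF)).le
    have hlt : (F.filter (fun y => y < x)).card < F.card :=
      Finset.card_lt_card (Finset.filter_ssubset.2 ⟨x, hxF, lt_irrefl x⟩)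
    rw [Finset.filter_insert, if_neg hxm,
      show F.card + 1 - 1 - (F.filter (fun y => y < x)).card =
        F.card - 1 - (F.filter (fun y => y < x)).card + 1 by omega, pow_succ]
    ring
  · simp

theorem relSign_eq_zero_of_not_subset {τ F : Finset ℕ} (h : ¬ τ ⊆ F) : relSign τ F = 0 :=
  if_neg fun h' => h h'.1

/-- Extend `ε` by the vertex `m`, with `η` prescribing the orientations of faces through `m`. -/
def coneExtend (m : ℕ) (ε η : Finset ℕ → ℤ) : Finset ℕ → ℤ :=
  fun σ => if m ∈ σ then η (σ.erase m) else ε σ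

theorem subset_range_succ_iff_of_notMem {m : ℕ} {σ : Finset ℕ} (h : m ∉ σ) :
    σ ⊆ Finset.range (m + 1) ↔ σ ⊆ Finset.range m := by
  rw [Finset.range_add_one, Finset.subset_insert_iff_of_notMem h]

theorem IsTournament.coneExtend {m d : ℕ} {ε η : Finset ℕ → ℤ}
    (hε : IsTournament (Finset.range m) (d + 1) ε) (hη : IsTournament (Finset.range m) d η) :
    IsTournament (Finset.range (m + 1)) (d + 1) (coneExtend m ε η) := by
  intro σ
  by_cases h : m ∈ σ
  · have hiff : (σ ⊆ Finset.range (m + 1) ∧ σ.card = d + 1 + 1) ↔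
        (σ.erase m ⊆ Finset.range m ∧ (σ.erase m).card = d + 1) := by
      rw [Finset.range_add_one, Finset.subset_insert_iff, ← Finset.card_erase_add_one h,
        Nat.add_right_cancel_iff]
    simp only [_root_.coneExtend, if_pos h, hiff]
    exact hη (σ.erase m)
  · simp only [_root_.coneExtend, if_neg h, subset_range_succ_iff_of_notMem h]
    exact hε σ

theorem IsAcyclic.coneExtend {m d : ℕ} {ε η : Finset ℕ → ℤ}
    (hε : IsAcyclic (Finset.range m) (d + 1) ε) (hη : IsAcyclic (Finset.range m) d η) :
    IsAcyclic (Finset.range (m + 1)) (d + 1) (coneExtend m ε η) := by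
  rintro C ⟨hne, hC, v, hv, hsum⟩
  by_cases hm : ∃ F ∈ C, m ∈ F
  · obtain ⟨F₀, hF₀, hmF₀⟩ := hm
    have hsub : ∀ F ∈ C, F.erase m ⊆ Finset.range m := fun F hF => by
      rw [← Finset.subset_insert_iff, ← Finset.range_add_one]
      exact (hC F hF).1
    have hinj : Set.InjOn (fun F : Finset ℕ => F.erase m) ↑(C.filter (fun F => m ∈ F)) := by
      intro F hF G hG h
      have hF := (Finset.mem_filter.1 (Finset.mem_coe.1 hF)).2
      have hG := (Finset.mem_filter.1 (Finset.mem_coe.1 hG)).2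
      rw [← Finset.insert_erase hF, ← Finset.insert_erase hG]
      exact congrArg (insert m) h
    refine hη ((C.filter (fun F => m ∈ F)).image (fun F => F.erase m))
      ⟨⟨F₀.erase m, Finset.mem_image_of_mem _ (Finset.mem_filter.2 ⟨hF₀, hmF₀⟩)⟩, ?_,
        fun F => v (insert m F), ?_, fun τ => ?_⟩
    · intro F hF
      obtain ⟨G, hG, rfl⟩ := Finset.mem_image.1 hF
      obtain ⟨hG, hmG⟩ := Finset.mem_filter.1 hG
      refine ⟨hsub G hG, ?_⟩
      rw [Finset.card_erase_of_mem hmG, (hC G hG).2, Nat.add_sub_cancel]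
    · intro F hF
      obtain ⟨G, hG, rfl⟩ := Finset.mem_image.1 hF
      obtain ⟨hG, hmG⟩ := Finset.mem_filter.1 hG
      simpa only [Finset.insert_erase hmG] using hv G hG
    · rw [Finset.sum_image hinj]
      by_cases hτ : m ∈ τ
      · refine Finset.sum_eq_zero fun F _ => ?_
        rw [relSign_eq_zero_of_not_subset fun h => Finset.notMem_erase m F (h hτ)]
        simp
      · rw [← neg_eq_zero, ← Finset.sum_neg_distrib, ← hsum (insert m τ), Finset.sum_filter]
        refine Finset.sum_congr rfl fun F hF => ?_
        split_ifs with hmF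
        · have hrel := relSign_insert_insert hτ (hsub F hF)
          rw [Finset.insert_erase hmF] at hrel
          simp only [Finset.insert_erase hmF, hrel, _root_.coneExtend, if_pos hmF]
          push_cast
          ring
        · rw [relSign_eq_zero_of_not_subset fun h => hmF (h (Finset.mem_insert_self m τ))]
          simp
  · push Not at hm
    refine hε C ⟨hne, fun F hF => ?_, v, hv, fun τ => ?_⟩
    · exact ⟨(subset_range_succ_iff_of_notMem (hm F hF)).1 (hC F hF).1, (hC F hF).2⟩
    · rw [← hsum τ]
      refine Finset.sum_congr rfl fun F hF => ?_
      rw [_root_.coneExtend, if_neg (hm F hF)]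

theorem acyclicCount_mul_le (d m : ℕ) :
    acyclicCount (d + 1) m * acyclicCount d m ≤ acyclicCount (d + 1) (m + 1) := by
  unfold acyclicCount
  have := finite_acyclic_tournaments (d + 1) (m + 1)
  rw [← Nat.card_prod]
  refine Nat.card_le_card_of_injective
    (fun p => ⟨coneExtend m p.1.1 p.2.1, p.1.2.1.coneExtend p.2.2.1,
      p.1.2.2.coneExtend p.2.2.2⟩) ?_
  rintro ⟨ε, η⟩ ⟨ε', η'⟩ h
  have h : coneExtend m ε.1 η.1 = coneExtend m ε'.1 η'.1 := congrArg Subtype.val h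
  refine Prod.ext (Subtype.ext (funext fun σ => ?_)) (Subtype.ext (funext fun σ => ?_))
  · by_cases hσ : m ∈ σ
    · have hno : ¬ σ ⊆ Finset.range m := fun hs => by simpa using hs hσ
      exact ((ε.2.1 σ).2 fun h => hno h.1).trans ((ε'.2.1 σ).2 fun h => hno h.1).symm
    · simpa [coneExtend, hσ] using congrFun h σ
  · by_cases hσ : m ∈ σ
    · have hno : ¬ σ ⊆ Finset.range m := fun hs => by simpa using hs hσ
      exact ((η.2.1 σ).2 fun h => hno h.1).trans ((η'.2.1 σ).2 fun h => hno h.1).symm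
    · simpa [coneExtend, Finset.erase_insert hσ] using congrFun h (insert m σ)

/-- for all `n ≥ d ≥ 2`, `a_d(n) ≥ ∏_{k=d-1}^{n-1} a_{d-1}(k)`. -/
theorem acyclicCount_recursion (n d : ℕ) (hd : 2 ≤ d) (hn : d ≤ n) :
    ∏ k ∈ Finset.Icc (d - 1) (n - 1), acyclicCount (d - 1) k ≤ acyclicCount d n := by
  obtain ⟨e, rfl⟩ : ∃ e, d = e + 1 := ⟨d - 1, by omega⟩
  induction n, hn using Nat.le_induction with
  | base => simp [acyclicCount_eq_one_of_le]
  | succ m hm ih =>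
    obtain ⟨k, rfl⟩ : ∃ k, m = k + 1 := ⟨m - 1, by omega⟩
    simp only [Nat.add_sub_cancel] at ih ⊢
    rw [Finset.prod_Icc_succ_top (by omega)]
    exact (Nat.mul_le_mul_right _ ih).trans (acyclicCount_mul_le e (k + 1))
end

section
/- For all integers n > d ≥ 1, the number a_d(n) of acyclic d-tournaments on vertex set [n] satisfies a_d(n) ≤ n^{binom(n,d)}. -/
open Finset

lemma relSign_eq_zero_or (τ σ : Finset ℕ) :
    relSign τ σ = 0 ∨ relSign τ σ = 1 ∨ relSign τ σ = -1 := by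
  unfold relSign
  split_ifs with h
  · have hc : (σ \ τ).card = 1 := by
      rw [card_sdiff_of_subset h.1]
      omega
    obtain ⟨x, hx⟩ := card_eq_one.mp hc
    rw [hx, sum_singleton]
    exact Or.inr (neg_one_pow_eq_or ℤ _)
  · exact Or.inl rfl

lemma relSign_eq_zero_of_not {τ σ : Finset ℕ} (h : ¬(τ ⊆ σ ∧ τ.card + 1 = σ.card)) :
    relSign τ σ = 0 :=
  if_neg h

/-- The faces of `V` which induce the positive orientation on `τ`. -/
def positiveFaces (V : Finset ℕ) (d : ℕ) (ε : Finset ℕ → ℤ) (τ : Finset ℕ) :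
    Finset (Finset ℕ) :=
  (V.powersetCard (d + 1)).filter fun F => ε F * relSign τ F = 1

lemma card_positiveFaces_le {V : Finset ℕ} {d : ℕ} (ε : Finset ℕ → ℤ) {τ : Finset ℕ}
    (hτ : τ ⊆ V) : (positiveFaces V d ε τ).card ≤ V.card - τ.card := by
  rw [← card_sdiff_of_subset hτ]
  refine le_trans (card_le_card ?_) (card_image_le (f := fun x => insert x τ))
  intro F hF
  obtain ⟨hFV, h1⟩ := mem_filter.mp hF
  have h : τ ⊆ F ∧ τ.card + 1 = F.card := by
    by_contra h
    simp [relSign_eq_zero_of_not h] at h1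
  obtain ⟨x, hx, rfl⟩ := exists_eq_insert_iff.mpr h
  exact mem_image.mpr
    ⟨x, mem_sdiff.mpr ⟨(mem_powersetCard.mp hFV).1 (mem_insert_self x τ), hx⟩, rfl⟩

/-- In a tournament, out-degrees determine the degree sequence. -/
lemma IsTournament.degSeq_eq {V : Finset ℕ} {d : ℕ} {ε : Finset ℕ → ℤ}
    (h : IsTournament V d ε) (τ : Finset ℕ) :
    degSeq V d ε τ =
      2 * (positiveFaces V d ε τ).card - ∑ F ∈ V.powersetCard (d + 1), |relSign τ F| := by
  rw [degSeq, positiveFaces, card_filter, Nat.cast_sum, mul_sum, ← sum_sub_distrib]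
  refine sum_congr rfl fun F hF => ?_
  rcases (h F).1 (mem_powersetCard.mp hF) with h1 | h1 <;>
    rcases relSign_eq_zero_or τ F with h2 | h2 | h2 <;> simp [h1, h2]

lemma degSeq_eq_zero {V : Finset ℕ} {d : ℕ} (ε : Finset ℕ → ℤ) {τ : Finset ℕ}
    (hτ : τ ∉ V.powersetCard d) : degSeq V d ε τ = 0 := by
  refine sum_eq_zero fun F hF => ?_
  obtain ⟨hFV, hFd⟩ := mem_powersetCard.mp hF
  rw [relSign_eq_zero_of_not, mul_zero]
  rintro ⟨h1, h2⟩
  exact hτ (mem_powersetCard.mpr ⟨h1.trans hFV, by omega⟩)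

/-- An acyclic tournament is determined by its degree sequence: the faces on which another
tournament with the same degree sequence differs would form a cycle. -/
lemma IsAcyclic.eq_of_degSeq_eq {V : Finset ℕ} {d : ℕ} {ε ε' : Finset ℕ → ℤ}
    (hε : IsTournament V d ε) (hε' : IsTournament V d ε') (ha : IsAcyclic V d ε)
    (hdeg : degSeq V d ε = degSeq V d ε') : ε = ε' := by
  by_contra hne
  obtain ⟨σ, hσ⟩ := Function.ne_iff.mp hne
  have hσV : σ ⊆ V ∧ σ.card = d + 1 := by
    by_contra h
    exact hσ (((hε σ).2 h).trans ((hε' σ).2 h).symm)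
  refine ha ((V.powersetCard (d + 1)).filter fun F => ε F ≠ ε' F)
    ⟨⟨σ, mem_filter.mpr ⟨mem_powersetCard.mpr hσV, hσ⟩⟩,
      fun F hF => mem_powersetCard.mp (mem_filter.mp hF).1,
      fun _ => 1, fun _ _ => one_pos, fun τ => ?_⟩
  have h2 : 2 * ∑ F ∈ (V.powersetCard (d + 1)).filter (fun F => ε F ≠ ε' F),
      ε F * relSign τ F = 0 := by
    have h3 : degSeq V d ε τ - degSeq V d ε' τ = 0 := by rw [hdeg, sub_self]
    rw [degSeq, degSeq, ← sum_sub_distrib] at h3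
    rw [← h3, sum_filter, mul_sum]
    refine sum_congr rfl fun F hF => ?_
    rcases (hε F).1 (mem_powersetCard.mp hF) with h | h <;>
      rcases (hε' F).1 (mem_powersetCard.mp hF) with h' | h' <;> simp [h, h'] <;> ring
  have h4 := (mul_eq_zero.mp h2).resolve_left two_ne_zero
  simp only [one_mul]
  exact_mod_cast h4

/-- for all `n > d ≥ 1`, `a_d(n) ≤ n^{C(n,d)}`. -/
theorem acyclicCount_le_pow (n d : ℕ) (hd : 1 ≤ d) (hn : d < n) :
    acyclicCount d n ≤ n ^ n.choose d := by
  let outDegree : {ε : Finset ℕ → ℤ //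
      IsTournament (range n) d ε ∧ IsAcyclic (range n) d ε} →
      ((range n).powersetCard d → Fin n) := fun ε τ =>
    ⟨(positiveFaces (range n) d ε.1 τ.1).card, by
      obtain ⟨h1, h2⟩ := mem_powersetCard.mp τ.2
      have h3 := card_positiveFaces_le (d := d) ε.1 h1
      rw [card_range, h2] at h3
      omega⟩
  have hinj : Function.Injective outDegree := by
    intro ε ε' h
    refine Subtype.ext (ε.2.2.eq_of_degSeq_eq ε.2.1 ε'.2.1 (funext fun τ => ?_))
    by_cases hτ : τ ∈ (range n).powersetCard d
    · have h1 : (positiveFaces (range n) d ε.1 τ).card =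
          (positiveFaces (range n) d ε'.1 τ).card :=
        congrArg Fin.val (congrFun h ⟨τ, hτ⟩)
      rw [ε.2.1.degSeq_eq, ε'.2.1.degSeq_eq, h1]
    · rw [degSeq_eq_zero _ hτ, degSeq_eq_zero _ hτ]
  have hcard := Nat.card_le_card_of_injective outDegree hinj
  rwa [Nat.card_fun, Nat.card_eq_fintype_card (α := Fin n), Fintype.card_fin,
    Nat.card_eq_fintype_card (α := (range n).powersetCard d), Fintype.card_coe,
    card_powersetCard, card_range] at hcard
end
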